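/- Let q be a prime power, K a finite field with q elements, K̄ an algebraic closure of K, and φ the Frobenius map on P¹(K̄) given by [a : b] ↦ [a^q : b^q]. The number of orbits of the componentwise action of PGL₂(K) on the set of ordered 6-tuples (x₁, …, x₆) of pairwise distinct points of P¹(K̄) satisfying φ(x₁) = x₂, φ(x₂) = x₃, φ(x₃) = x₄, φ(x₄) = x₅, φ(x₅) = x₆ and φ(x₆) = x₁ equals q³ + q − 1. -/

import Mathlib

open Projectivization

/-! ## The projective line and the actions of `GL₂` and `PGL₂` -/

/-- `GL₂(L)` as a group of linear automorphisms of `L²`. -/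
noncomputable def glMulEquiv (L : Type*) [Field L] :
    GL (Fin 2) L ≃* ((Fin 2 → L) ≃ₗ[L] (Fin 2 → L)) :=
  (Matrix.GeneralLinearGroup.toLin).trans
    (LinearMap.GeneralLinearGroup.generalLinearEquiv L (Fin 2 → L))

theorem glMulEquiv_apply (L : Type*) [Field L] (g : GL (Fin 2) L) (v : Fin 2 → L) :
    glMulEquiv L g v = (g : Matrix (Fin 2) (Fin 2) L).mulVec v := by
  simp [glMulEquiv]

/-- The action of `GL₂(L)` on the projective line `P¹(L)`, given in homogeneous
coordinates by `[a : b] ↦ [α a + β b : γ a + δ b]`. -/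
noncomputable def glP1 (L : Type*) [Field L] :
    GL (Fin 2) L →* Function.End (Projectivization L (Fin 2 → L)) where
  toFun g := Projectivization.map (glMulEquiv L g).toLinearMap (glMulEquiv L g).injective
  map_one' := by
    funext x
    induction x using Projectivization.ind with
    | h v hv =>
      show Projectivization.map (glMulEquiv L 1).toLinearMap (glMulEquiv L 1).injective
          (Projectivization.mk L v hv) = Projectivization.mk L v hv
      rw [Projectivization.map_mk, Projectivization.mk_eq_mk_iff']
      exact ⟨1, by simp [glMulEquiv_apply]⟩
  map_mul' g h := by
    funext x
    induction x using Projectivization.ind with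
    | h v hv =>
      show Projectivization.map (glMulEquiv L (g * h)).toLinearMap
          (glMulEquiv L (g * h)).injective (Projectivization.mk L v hv)
        = Projectivization.map (glMulEquiv L g).toLinearMap (glMulEquiv L g).injective
            (Projectivization.map (glMulEquiv L h).toLinearMap (glMulEquiv L h).injective
              (Projectivization.mk L v hv))
      rw [Projectivization.map_mk, Projectivization.map_mk, Projectivization.map_mk,
        Projectivization.mk_eq_mk_iff']
      exact ⟨1, by simp [glMulEquiv_apply, Matrix.mulVec_mulVec]⟩

/-- The action of `GL₂(L)` on `P¹(L)` as a `MulAction`. -/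
noncomputable instance glP1Action (L : Type*) [Field L] :
    MulAction (GL (Fin 2) L) (Projectivization L (Fin 2 → L)) :=
  MulAction.ofEndHom (glP1 L)

/-- The subgroup of scalar matrices inside `GL₂(L)`. -/
def scalarSubgroup (L : Type*) [Field L] : Subgroup (GL (Fin 2) L) :=
  (Units.map ((Matrix.scalar (Fin 2)) : L →+* Matrix (Fin 2) (Fin 2) L).toMonoidHom).range

instance scalarSubgroup_normal (L : Type*) [Field L] : (scalarSubgroup L).Normal := by
  constructor
  rintro n ⟨a, rfl⟩ g
  refine ⟨a, ?_⟩
  have hc : Commute (Units.map ((Matrix.scalar (Fin 2)) :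
      L →+* Matrix (Fin 2) (Fin 2) L).toMonoidHom a) g := by
    apply Units.ext
    simpa using (Matrix.scalar_commute (a : L) (fun r => mul_comm _ _)
      (g : Matrix (Fin 2) (Fin 2) L)).eq
  rw [← hc.eq, mul_assoc, mul_inv_cancel, mul_one]

/-- `PGL₂(K)`: the quotient of `GL₂(K)` by the subgroup of scalar matrices. -/
abbrev PGL2 (K : Type*) [Field K] := GL (Fin 2) K ⧸ scalarSubgroup K

/-- Scalar matrices act trivially on the projective line. -/
theorem glP1_scalar_eq_one (L : Type*) [Field L] (a : Lˣ) :
    glP1 L (Units.map ((Matrix.scalar (Fin 2)) :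
      L →+* Matrix (Fin 2) (Fin 2) L).toMonoidHom a) = 1 := by
  set u := Units.map ((Matrix.scalar (Fin 2)) :
      L →+* Matrix (Fin 2) (Fin 2) L).toMonoidHom a with hu
  funext x
  induction x using Projectivization.ind with
  | h v hv =>
    show Projectivization.map (glMulEquiv L u).toLinearMap (glMulEquiv L u).injective
        (Projectivization.mk L v hv) = Projectivization.mk L v hv
    rw [Projectivization.map_mk, Projectivization.mk_eq_mk_iff']
    refine ⟨(a : L), ?_⟩
    simp [glMulEquiv_apply, hu, Matrix.scalar_apply, Matrix.diagonal_const_mulVec]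

/-- For a field homomorphism `f : K →+* L`, the scalar matrices of `GL₂(K)` act trivially on
`P¹(L)`, hence the action of `GL₂(K)` on `P¹(L)` descends to an action of `PGL₂(K)`. -/
noncomputable def pglP1 {K L : Type*} [Field K] [Field L] (f : K →+* L) :
    PGL2 K →* Function.End (Projectivization L (Fin 2 → L)) :=
  QuotientGroup.lift (scalarSubgroup K)
    ((glP1 L).comp (Matrix.GeneralLinearGroup.map f))
    (by
      rintro z ⟨a, rfl⟩
      have key : Matrix.GeneralLinearGroup.map (n := Fin 2) f
          (Units.map ((Matrix.scalar (Fin 2)) : K →+* Matrix (Fin 2) (Fin 2) K).toMonoidHom a)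
          = Units.map ((Matrix.scalar (Fin 2)) :
              L →+* Matrix (Fin 2) (Fin 2) L).toMonoidHom (Units.map f.toMonoidHom a) := by
        apply Units.ext
        ext i j
        simp [Matrix.GeneralLinearGroup.map, Matrix.scalar_apply, Matrix.diagonal,
          Matrix.map_apply, apply_ite f]
      rw [MonoidHom.mem_ker, MonoidHom.comp_apply, key, glP1_scalar_eq_one])

/-- The action of `PGL₂(K)` on `P¹(L)`, for any extension `L` of `K` via `f : K →+* L`. -/
noncomputable def pglP1Action {K L : Type*} [Field K] [Field L] (f : K →+* L) :
    MulAction (PGL2 K) (Projectivization L (Fin 2 → L)) :=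
  MulAction.ofEndHom (pglP1 f)
/-- The Frobenius map on the projective line `P¹(L)`, acting in homogeneous coordinates by
`[a : b] ↦ [a ^ q : b ^ q]`. -/
noncomputable def frobP1 {L : Type*} [Field L] (q : ℕ)
    (x : Projectivization L (Fin 2 → L)) : Projectivization L (Fin 2 → L) :=
  Projectivization.mk L (fun i => (x.rep i) ^ q) (by
    intro hzero
    obtain ⟨i, hi⟩ := Function.ne_iff.mp x.rep_nonzero
    have h2 : x.rep i ^ q = 0 := congrFun hzero i
    exact hi (by simpa using (pow_eq_zero_iff'.mp h2).1))

noncomputable instance pglP1ClosureAction (K : Type*) [Field K] :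
    MulAction (PGL2 K)
      (Projectivization (AlgebraicClosure K) (Fin 2 → AlgebraicClosure K)) :=
  pglP1Action (algebraMap K (AlgebraicClosure K))

section FrobeniusCycles

open Polynomial

theorem frobP1_mk {L : Type*} [Field L] (q : ℕ) (v : Fin 2 → L) (hv : v ≠ 0)
    (hw : (fun i => v i ^ q) ≠ 0) :
    frobP1 q (Projectivization.mk L v hv) = Projectivization.mk L (fun i => v i ^ q) hw := by
  obtain ⟨c, hc⟩ := Projectivization.exists_smul_eq_mk_rep L v hv
  rw [frobP1, Projectivization.mk_eq_mk_iff']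
  refine ⟨(c : L) ^ q, ?_⟩
  ext i
  simp [← hc, Units.smul_def, mul_pow]

/-- The affine point `[a : 1]` of the projective line. -/
def affinePoint {L : Type*} [Field L] (a : L) : Projectivization L (Fin 2 → L) :=
  Projectivization.mk L ![a, 1] (fun h => by simpa using congrFun h 1)

theorem affinePoint_injective {L : Type*} [Field L] :
    Function.Injective (affinePoint : L → Projectivization L (Fin 2 → L)) := by
  intro a b h
  rw [affinePoint, affinePoint, Projectivization.mk_eq_mk_iff'] at h
  obtain ⟨c, hc⟩ := h
  have h0 := congrFun hc 0
  have h1 := congrFun hc 1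
  simp only [Pi.smul_apply, smul_eq_mul, Matrix.cons_val_zero, Matrix.cons_val_one,
    mul_one] at h0 h1
  rw [← h0, h1, one_mul]

theorem frobP1_affinePoint {L : Type*} [Field L] (q : ℕ) (a : L) :
    frobP1 q (affinePoint a) = affinePoint (a ^ q) := by
  have h : (fun i => (![a, 1] : Fin 2 → L) i ^ q) = ![a ^ q, 1] := by
    ext i
    fin_cases i <;> simp
  have hw : (fun i => (![a, 1] : Fin 2 → L) i ^ q) ≠ 0 := fun h0 => by
    simpa using congrFun h0 1
  rw [affinePoint, frobP1_mk q _ _ hw]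
  simp only [h, affinePoint]

theorem exists_affinePoint_of_frobP1_ne {L : Type*} [Field L] {q : ℕ} (hq : q ≠ 0)
    (x : Projectivization L (Fin 2 → L)) (hx : frobP1 q x ≠ x) : ∃ a, x = affinePoint a := by
  induction x using Projectivization.ind with
  | h v hv =>
    by_cases h1 : v 1 = 0
    · refine absurd ?_ hx
      have h0 : v 0 ≠ 0 := fun h0 => hv (by ext i; fin_cases i <;> simp [h0, h1])
      have hw : (fun i => v i ^ q) ≠ 0 := fun h => h0 (by simpa [hq] using congrFun h 0)
      rw [frobP1_mk q v hv hw, Projectivization.mk_eq_mk_iff']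
      refine ⟨v 0 ^ q / v 0, ?_⟩
      ext i
      fin_cases i <;> simp [h0, h1, hq]
    · refine ⟨v 0 / v 1, ?_⟩
      rw [affinePoint, Projectivization.mk_eq_mk_iff']
      refine ⟨v 1, ?_⟩
      ext i
      fin_cases i <;> simp [h1, mul_div_cancel₀]

variable (K : Type*) [Field K]

theorem pgl2_mk_smul_mk (g : GL (Fin 2) K) (v : Fin 2 → AlgebraicClosure K) (hv : v ≠ 0)
    (hw : ((g : Matrix (Fin 2) (Fin 2) K).map
      (algebraMap K (AlgebraicClosure K))).mulVec v ≠ 0) :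
    (QuotientGroup.mk g : PGL2 K) • Projectivization.mk (AlgebraicClosure K) v hv =
      Projectivization.mk (AlgebraicClosure K) _ hw := by
  let h := Matrix.GeneralLinearGroup.map (algebraMap K (AlgebraicClosure K)) g
  change Projectivization.map (glMulEquiv (AlgebraicClosure K) h).toLinearMap
    (glMulEquiv (AlgebraicClosure K) h).injective
    (Projectivization.mk (AlgebraicClosure K) v hv) = _
  rw [Projectivization.map_mk, Projectivization.mk_eq_mk_iff']
  refine ⟨1, ?_⟩
  rw [one_smul]
  exact (glMulEquiv_apply _ h v).symm

theorem map_mulVec_ne_zero (g : GL (Fin 2) K) {v : Fin 2 → AlgebraicClosure K} (hv : v ≠ 0) :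
    ((g : Matrix (Fin 2) (Fin 2) K).map
      (algebraMap K (AlgebraicClosure K))).mulVec v ≠ 0 := by
  have h : glMulEquiv (AlgebraicClosure K)
      (Matrix.GeneralLinearGroup.map (algebraMap K (AlgebraicClosure K)) g) v ≠ 0 :=
    (glMulEquiv (AlgebraicClosure K) _).map_ne_zero_iff.mpr hv
  rw [glMulEquiv_apply] at h
  exact h

theorem pgl2_mk_eq_one {g : GL (Fin 2) K} {a b c : AlgebraicClosure K}
    (hab : a ≠ b) (hac : a ≠ c) (hbc : b ≠ c)
    (ha : (QuotientGroup.mk g : PGL2 K) • affinePoint a = affinePoint a)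
    (hb : (QuotientGroup.mk g : PGL2 K) • affinePoint b = affinePoint b)
    (hc : (QuotientGroup.mk g : PGL2 K) • affinePoint c = affinePoint c) :
    (QuotientGroup.mk g : PGL2 K) = 1 := by
  let f := algebraMap K (AlgebraicClosure K)
  have key : ∀ t : AlgebraicClosure K,
      (QuotientGroup.mk g : PGL2 K) • affinePoint t = affinePoint t →
      f (g 0 0) * t + f (g 0 1) = (f (g 1 0) * t + f (g 1 1)) * t := by
    intro t ht
    rw [affinePoint, pgl2_mk_smul_mk K g _ _
      (map_mulVec_ne_zero K g (fun h => by simpa using congrFun h 1)),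
      Projectivization.mk_eq_mk_iff'] at ht
    obtain ⟨c, hc⟩ := ht
    have h0 := congrFun hc 0
    have h1 := congrFun hc 1
    simp [Matrix.mulVec, dotProduct, Fin.sum_univ_two] at h0 h1
    change _ = f _ * t + f _ at h0
    change _ = f _ * t + f _ at h1
    rw [← h0, ← h1]
  have ea := key a ha
  have eb := key b hb
  have ec := key c hc
  have h1 : f (g 0 0) - f (g 1 1) = f (g 1 0) * (a + b) :=
    mul_left_cancel₀ (sub_ne_zero.mpr hab) (by linear_combination ea - eb)
  have h2 : f (g 0 0) - f (g 1 1) = f (g 1 0) * (a + c) :=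
    mul_left_cancel₀ (sub_ne_zero.mpr hac) (by linear_combination ea - ec)
  have h10 : f (g 1 0) = 0 :=
    (mul_eq_zero.mp (show f (g 1 0) * (b - c) = 0 by linear_combination h2 - h1)).resolve_right
      (sub_ne_zero.mpr hbc)
  have hd : f (g 0 0) = f (g 1 1) := by linear_combination h1 + (a + b) * h10
  have h01 : f (g 0 1) = 0 := by linear_combination ea - a * hd + a ^ 2 * h10
  have h10' : g 1 0 = 0 := by simpa using h10
  have h01' : g 0 1 = 0 := by simpa using h01
  have hd' : g 0 0 = g 1 1 := f.injective hd
  have h00 : g 0 0 ≠ 0 := by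
    intro h
    have hdet := g.det.ne_zero
    simp [Matrix.GeneralLinearGroup.val_det_apply, Matrix.det_fin_two, h, h10'] at hdet
  rw [QuotientGroup.eq_one_iff]
  refine ⟨Units.mk0 _ h00, ?_⟩
  apply Units.ext
  ext i j
  fin_cases i <;> fin_cases j <;> simp [h10', h01', hd']

variable [Fintype K]

theorem frobP1_smul (g : PGL2 K)
    (x : Projectivization (AlgebraicClosure K) (Fin 2 → AlgebraicClosure K)) :
    frobP1 (Fintype.card K) (g • x) = g • frobP1 (Fintype.card K) x := by
  induction g using QuotientGroup.induction_on with
  | H g =>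
  induction x using Projectivization.ind with
  | h v hv =>
    have hq : Fintype.card K ≠ 0 := Fintype.card_ne_zero
    have hpow : ∀ w : Fin 2 → AlgebraicClosure K, w ≠ 0 →
        (fun i => w i ^ Fintype.card K) ≠ 0 := fun w hw h =>
      hw (by ext i; simpa [hq] using congrFun h i)
    have hg := map_mulVec_ne_zero K g hv
    rw [pgl2_mk_smul_mk K g v hv hg, frobP1_mk _ _ _ (hpow _ hg), frobP1_mk _ _ _ (hpow _ hv),
      pgl2_mk_smul_mk K g _ _ (map_mulVec_ne_zero K g (hpow _ hv))]
    congr 1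
    ext i
    simp only [Matrix.mulVec, dotProduct, Fin.sum_univ_two, Matrix.map_apply]
    simp only [← FiniteField.frobeniusAlgHom_apply K (AlgebraicClosure K), map_add, map_mul,
      AlgHom.commutes]

theorem card_scalarSubgroup : Nat.card (scalarSubgroup K) = Fintype.card K - 1 := by
  have hinj : Function.Injective (Units.map ((Matrix.scalar (Fin 2)) :
      K →+* Matrix (Fin 2) (Fin 2) K).toMonoidHom) :=
    Units.map_injective (fun a b h => Matrix.scalar_inj.mp h)
  rw [scalarSubgroup, ← Nat.card_congr (MonoidHom.ofInjective hinj).toEquiv, Nat.card_units,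
    Nat.card_eq_fintype_card]

theorem card_PGL2 : (Nat.card (PGL2 K) : ℤ) = (Fintype.card K : ℤ) ^ 3 - Fintype.card K := by
  have h := Subgroup.card_eq_card_quotient_mul_card_subgroup (scalarSubgroup K)
  rw [Matrix.card_GL_field, card_scalarSubgroup] at h
  have hq : 1 < Fintype.card K := Fintype.one_lt_card
  have h' := congrArg (Nat.cast : ℕ → ℤ) h
  rw [Fin.prod_univ_two] at h'
  push_cast [Nat.cast_sub (Nat.pow_le_pow_right hq.le (show ((0 : Fin 2) : ℕ) ≤ 2 by simp)),
    Nat.cast_sub (Nat.pow_le_pow_right hq.le (show ((1 : Fin 2) : ℕ) ≤ 2 by simp)),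
    Nat.cast_sub hq.le] at h'
  simp at h'
  have hne : (Fintype.card K : ℤ) - 1 ≠ 0 := by
    have : (1 : ℤ) < Fintype.card K := by exact_mod_cast hq
    linarith
  refine mul_right_cancel₀ hne ?_
  rw [← h']
  ring

/-- The elements of `K̄` fixed by the `n`-th power of the Frobenius. -/
def frobFixed (n : ℕ) : Set (AlgebraicClosure K) := {a | a ^ Fintype.card K ^ n = a}

theorem ncard_frobFixed {n : ℕ} (hn : n ≠ 0) :
    (frobFixed K n).ncard = Fintype.card K ^ n := by
  have hq : 1 < Fintype.card K := Fintype.one_lt_card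
  obtain ⟨p, _, hp, hd⟩ : ∃ p : ℕ, ∃ _ : CharP K p, p.Prime ∧ p ∣ Fintype.card K := by
    obtain ⟨p, hc⟩ := CharP.exists K
    obtain ⟨m, hp, hm⟩ := FiniteField.card K p
    exact ⟨p, hc, hp, hm ▸ dvd_pow_self p m.ne_zero⟩
  have hsep : (X ^ Fintype.card K ^ n - X : K[X]).Separable :=
    galois_poly_separable p _ (hd.trans (dvd_pow_self _ hn))
  have hne := FiniteField.X_pow_card_pow_sub_X_ne_zero K hn hq
  have hset : frobFixed K n =
      (X ^ Fintype.card K ^ n - X : K[X]).rootSet (AlgebraicClosure K) := by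
    ext a
    rw [mem_rootSet_of_ne hne]
    simp [frobFixed, sub_eq_zero]
  rw [hset, ← Nat.card_coe_set_eq, Nat.card_eq_fintype_card,
    card_rootSet_eq_natDegree hsep (IsAlgClosed.splits _),
    FiniteField.X_pow_card_pow_sub_X_natDegree_eq K hn hq]

variable {K} in
theorem frobFixed_iff_isPeriodicPt (n : ℕ) (a : AlgebraicClosure K) :
    a ∈ frobFixed K n ↔
      Function.IsPeriodicPt (FiniteField.frobeniusAlgHom K (AlgebraicClosure K)) n a := by
  rw [Function.IsPeriodicPt, Function.IsFixedPt, FiniteField.coe_frobeniusAlgHom, pow_iterate]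
  rfl

theorem frobFixed_inter (m n : ℕ) : frobFixed K m ∩ frobFixed K n = frobFixed K (m.gcd n) := by
  ext a
  simp only [Set.mem_inter_iff, frobFixed_iff_isPeriodicPt]
  exact ⟨fun h => h.1.gcd h.2, fun h =>
    ⟨h.trans_dvd (m.gcd_dvd_left n), h.trans_dvd (m.gcd_dvd_right n)⟩⟩

theorem frobFixed_mono {m n : ℕ} (h : m ∣ n) : frobFixed K m ⊆ frobFixed K n := by
  intro a
  simp only [frobFixed_iff_isPeriodicPt]
  exact fun ha => ha.trans_dvd h

theorem ncard_frobFixed_six_diff :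
    ((frobFixed K 6 \ (frobFixed K 2 ∪ frobFixed K 3)).ncard : ℤ) =
      (Fintype.card K : ℤ) ^ 6 - Fintype.card K ^ 3 - Fintype.card K ^ 2 + Fintype.card K := by
  have hfin : ∀ {n : ℕ}, n ≠ 0 → (frobFixed K n).Finite := fun hn =>
    Set.finite_of_ncard_ne_zero (by rw [ncard_frobFixed K hn]; simp)
  have hsub : frobFixed K 2 ∪ frobFixed K 3 ⊆ frobFixed K 6 :=
    Set.union_subset (frobFixed_mono K (by norm_num)) (frobFixed_mono K (by norm_num))
  have h1 := Set.ncard_sdiff_add_ncard_of_subset hsub (hfin (by norm_num))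
  have h2 := Set.ncard_union_add_ncard_inter (frobFixed K 2) (frobFixed K 3)
    (hfin (by norm_num)) (hfin (by norm_num))
  rw [frobFixed_inter] at h2
  rw [ncard_frobFixed K (by norm_num)] at h1
  rw [ncard_frobFixed K (by norm_num), ncard_frobFixed K (by norm_num),
    ncard_frobFixed K (by norm_num)] at h2
  norm_num at h2
  zify at h1 h2
  linarith

/-- The exact Frobenius 6-cycles of points on the projective line. -/
def frobCycles :
    Set (Fin 6 → Projectivization (AlgebraicClosure K) (Fin 2 → AlgebraicClosure K)) :=
  {x | Function.Injective x ∧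
    frobP1 (Fintype.card K) (x 0) = x 1 ∧
    frobP1 (Fintype.card K) (x 1) = x 2 ∧
    frobP1 (Fintype.card K) (x 2) = x 3 ∧
    frobP1 (Fintype.card K) (x 3) = x 4 ∧
    frobP1 (Fintype.card K) (x 4) = x 5 ∧
    frobP1 (Fintype.card K) (x 5) = x 0}

variable {K} in
theorem exists_affinePoint_of_mem_frobCycles {x} (hx : x ∈ frobCycles K) :
    ∃ a, ∀ i : Fin 6, x i = affinePoint (a ^ Fintype.card K ^ (i : ℕ)) := by
  obtain ⟨hinj, h0, h1, h2, h3, h4, h5⟩ := hx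
  obtain ⟨a, ha⟩ := exists_affinePoint_of_frobP1_ne
    (q := Fintype.card K) Fintype.card_ne_zero (x 0) (by rw [h0]; exact hinj.ne (by decide))
  have e1 := h0.symm
  rw [ha, frobP1_affinePoint] at e1
  have e2 := h1.symm
  rw [e1, frobP1_affinePoint] at e2
  have e3 := h2.symm
  rw [e2, frobP1_affinePoint] at e3
  have e4 := h3.symm
  rw [e3, frobP1_affinePoint] at e4
  have e5 := h4.symm
  rw [e4, frobP1_affinePoint] at e5
  refine ⟨a, fun i => ?_⟩
  fin_cases i
  · simpa using ha
  · simpa using e1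
  · simpa [← pow_mul, pow_succ] using e2
  · simpa [← pow_mul, pow_succ] using e3
  · simpa [← pow_mul, pow_succ] using e4
  · simpa [← pow_mul, pow_succ] using e5

variable {K} in
theorem affinePoint_mem_frobCycles_iff (a : AlgebraicClosure K) :
    (fun i : Fin 6 => affinePoint (a ^ Fintype.card K ^ (i : ℕ))) ∈ frobCycles K ↔
      a ∈ frobFixed K 6 \ (frobFixed K 2 ∪ frobFixed K 3) := by
  set F := FiniteField.frobeniusAlgHom K (AlgebraicClosure K) with hF
  have hpow : ∀ n : ℕ, a ^ Fintype.card K ^ n = F^[n] a := fun n => by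
    rw [hF, FiniteField.coe_frobeniusAlgHom, pow_iterate]
  have hstep : ∀ n : ℕ, frobP1 (Fintype.card K) (affinePoint (F^[n] a)) =
      affinePoint (F^[n + 1] a) := fun n => by
    rw [frobP1_affinePoint, Function.iterate_succ_apply', hF, FiniteField.frobeniusAlgHom_apply]
  simp only [Set.mem_sdiff, Set.mem_union, frobFixed_iff_isPeriodicPt, hpow]
  rw [← hF]
  constructor
  · rintro ⟨hinj, -, -, -, -, -, h5⟩
    have hne : ∀ n : Fin 6, n ≠ 0 → ¬ Function.IsPeriodicPt F n a := fun n hn h =>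
      hn (hinj (congrArg affinePoint h))
    refine ⟨?_, ?_⟩
    · exact affinePoint_injective ((hstep 5).symm.trans h5)
    · rintro (h | h)
      · exact hne 2 (by decide) h
      · exact hne 3 (by decide) h
  · rintro ⟨h6, h23⟩
    have hper : Function.minimalPeriod F a = 6 := by
      have hdvd := h6.minimalPeriod_dvd
      have hmem : Function.minimalPeriod F a ∈ Nat.divisors 6 := by simp [hdvd]
      have hdiv : Nat.divisors 6 = {1, 2, 3, 6} := by decide
      have h2 := mt (Function.isPeriodicPt_iff_minimalPeriod_dvd (n := 2)).mpr
        (fun h => h23 (.inl h))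
      have h3 := mt (Function.isPeriodicPt_iff_minimalPeriod_dvd (n := 3)).mpr
        (fun h => h23 (.inr h))
      rw [hdiv] at hmem
      simp only [Finset.mem_insert, Finset.mem_singleton] at hmem
      rcases hmem with h | h | h | h
      · exact absurd (h ▸ by norm_num) h2
      · exact absurd (h ▸ by norm_num) h2
      · exact absurd (h ▸ by norm_num) h3
      · exact h
    refine ⟨fun i j hij => Fin.ext ?_, hstep 0, hstep 1, hstep 2, hstep 3, hstep 4,
      (hstep 5).trans (congrArg affinePoint h6)⟩
    exact Function.iterate_injOn_Iio_minimalPeriod (by rw [hper]; exact i.2)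
      (by rw [hper]; exact j.2) (affinePoint_injective hij)

theorem card_frobCycles : (Nat.card (frobCycles K) : ℤ) =
    (Fintype.card K : ℤ) ^ 6 - Fintype.card K ^ 3 - Fintype.card K ^ 2 + Fintype.card K := by
  rw [← ncard_frobFixed_six_diff, ← Nat.card_coe_set_eq]
  congr 1
  symm
  refine Nat.card_congr (Equiv.ofBijective
    (fun a => ⟨_, (affinePoint_mem_frobCycles_iff a.1).mpr a.2⟩) ⟨?_, ?_⟩)
  · intro a b h
    have h0 := congrFun (congrArg Subtype.val h) 0
    exact Subtype.ext (by simpa using affinePoint_injective h0)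
  · rintro ⟨x, hx⟩
    obtain ⟨a, ha⟩ := exists_affinePoint_of_mem_frobCycles hx
    obtain rfl : x = _ := funext ha
    exact ⟨⟨a, (affinePoint_mem_frobCycles_iff a).mp hx⟩, rfl⟩

/-- The set of exact Frobenius 6-cycles with its `PGL₂(K)`-action. -/
def frobCyclesSubMulAction : SubMulAction (PGL2 K)
    (Fin 6 → Projectivization (AlgebraicClosure K) (Fin 2 → AlgebraicClosure K)) where
  carrier := frobCycles K
  smul_mem' g x := by
    rintro ⟨hinj, h0, h1, h2, h3, h4, h5⟩
    refine ⟨fun i j hij => hinj (MulAction.injective g hij), ?_⟩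
    simp only [Pi.smul_apply, frobP1_smul, h0, h1, h2, h3, h4, h5, and_self]

theorem stabilizer_frobCycles (x : frobCyclesSubMulAction K) :
    MulAction.stabilizer (PGL2 K) x = ⊥ := by
  rw [eq_bot_iff]
  intro g hg
  obtain ⟨a, ha⟩ := exists_affinePoint_of_mem_frobCycles x.2
  have hfix : ∀ i : Fin 6, g • affinePoint (a ^ Fintype.card K ^ (i : ℕ)) =
      affinePoint (a ^ Fintype.card K ^ (i : ℕ)) := fun i => by
    rw [← ha]
    exact congrFun (congrArg Subtype.val hg) i
  have hne : ∀ i j : Fin 6, i ≠ j →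
      a ^ Fintype.card K ^ (i : ℕ) ≠ a ^ Fintype.card K ^ (j : ℕ) :=
    fun i j hij h => hij (x.2.1 (by rw [ha, ha, h]))
  induction g using QuotientGroup.induction_on with
  | H g =>
    exact pgl2_mk_eq_one K (hne 0 1 (by decide)) (hne 0 2 (by decide)) (hne 1 2 (by decide))
      (hfix 0) (hfix 1) (hfix 2)

theorem card_orbits_frobCycles :
    (Nat.card (Quotient (MulAction.orbitRel (PGL2 K) (frobCyclesSubMulAction K))) : ℤ) =
      (Fintype.card K : ℤ) ^ 3 + Fintype.card K - 1 := by
  have h := Nat.card_congr (MulAction.selfEquivOrbitsQuotientProd (stabilizer_frobCycles K))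
  rw [Nat.card_prod] at h
  have h' := congrArg (Nat.cast : ℕ → ℤ) h
  have hc : (Nat.card (frobCyclesSubMulAction K) : ℤ) = _ := card_frobCycles K
  push_cast at h'
  rw [hc, card_PGL2] at h'
  have hq : (1 : ℤ) < Fintype.card K := by exact_mod_cast Fintype.one_lt_card (α := K)
  have hne : (Fintype.card K : ℤ) ^ 3 - Fintype.card K ≠ 0 := by
    have : (0 : ℤ) < Fintype.card K * (Fintype.card K - 1) * (Fintype.card K + 1) := by
      have := sub_pos.mpr hq
      positivity
    nlinarith
  refine mul_right_cancel₀ hne ?_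
  rw [← h']
  ring

end FrobeniusCycles

/-- the number of `PGL₂(K)`-orbits of injective 6-tuples on `P¹(K̄)`
satisfying the stated Frobenius conditions. -/
theorem statement13 (q : ℕ) (hq : IsPrimePow q)
    (K : Type*) [Field K] [Fintype K] (hK : Fintype.card K = q) :
    (Nat.card (Quotient (Setoid.comap
      (Subtype.val :
        {x : Fin 6 → Projectivization (AlgebraicClosure K) (Fin 2 → AlgebraicClosure K) //
          Function.Injective x ∧
          frobP1 q (x 0) = x 1 ∧
          frobP1 q (x 1) = x 2 ∧
          frobP1 q (x 2) = x 3 ∧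
          frobP1 q (x 3) = x 4 ∧
          frobP1 q (x 4) = x 5 ∧
          frobP1 q (x 5) = x 0} →
        (Fin 6 → Projectivization (AlgebraicClosure K) (Fin 2 → AlgebraicClosure K)))
      (MulAction.orbitRel (PGL2 K)
        (Fin 6 → Projectivization (AlgebraicClosure K) (Fin 2 → AlgebraicClosure K))))) : ℤ)
    = (q : ℤ) ^ 3 + (q : ℤ) - 1 := by
  subst hK
  rw [← card_orbits_frobCycles K]
  congr 1
  refine Nat.card_congr (Quotient.congr (Equiv.refl _) fun x y => ?_)
  change MulAction.orbitRel _ _ _ _ ↔ MulAction.orbitRel _ _ _ _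
  simp only [MulAction.orbitRel_apply]
  exact (SubMulAction.mem_orbit_subMul_iff (p := frobCyclesSubMulAction K)).symm
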